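/- arXiv:1506.03353 — 2 statements merged into one kernel-verified Lean document; each statement's English description precedes it below -/
import Mathlib

section
/- Let M, N be natural numbers with M > N, let p > 0 and β > 0 be real constants, let K be a finite index set, and let p_k ≥ 0 and β_k > 0 for k ∈ K be real constants. Let z be an almost surely positive random variable with E[1/z] = 1/(M − N), and let (A_k)_{k∈K} be nonnegative integrable random variables with E[A_k] = β_k for each k. Set S = Σ_{k∈K} p_k A_k and assume z is independent of S and that log2(1 + p·β·z/(S + 1)) is integrable. Then E[log2(1 + p·β·z/(S + 1))] ≥ log2(1 + p·β·(M − N)/(Σ_{k∈K} p_k β_k + 1)). -/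
open MeasureTheory ProbabilityTheory

lemma tangent_aux (c m x : ℝ) (hc : 0 < c) (hm : 0 < m) (hx : 0 < x) :
    Real.log (1 + c / m) + c / (m * (m + c)) * (m - x) ≤ Real.log (1 + c / x) := by
  have h1 : Real.log (x * (m + c) / ((x + c) * m)) ≤ x * (m + c) / ((x + c) * m) - 1 :=
    Real.log_le_sub_one_of_pos (by positivity)
  have h2 : Real.log (x * (m + c) / ((x + c) * m))
      = Real.log (1 + c / m) - Real.log (1 + c / x) := by
    rw [← Real.log_div (by positivity) (by positivity)]
    congr 1
    field_simp
  have h3 : c / (m * (m + c)) * (m - x) ≤ 1 - x * (m + c) / ((x + c) * m) := by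
    have : 1 - x * (m + c) / ((x + c) * m) - c / (m * (m + c)) * (m - x)
        = c * (m - x) ^ 2 / (m * (m + c) * (x + c)) := by
      field_simp
      ring
    have h4 : 0 ≤ c * (m - x) ^ 2 / (m * (m + c) * (x + c)) := by positivity
    linarith
  linarith

/-- Core inequality of Theorem 1 of the paper (lower bound on the achievable uplink rate):
`E[log2(1 + pβz/(S+1))] ≥ log2(1 + pβ(M−N)/(Σ_k p_k β_k + 1))`. -/
theorem stmt4
    {Ω : Type*} [MeasurableSpace Ω] (μ : Measure Ω) [IsProbabilityMeasure μ]
    {ι : Type*} [Fintype ι]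
    (M N : ℕ) (hMN : N < M) (p β : ℝ) (hp : 0 < p) (hβ : 0 < β)
    (pk βk : ι → ℝ) (hpk : ∀ k, 0 ≤ pk k) (hβk : ∀ k, 0 < βk k)
    (z : Ω → ℝ) (hzm : Measurable z) (hzpos : ∀ᵐ ω ∂μ, 0 < z ω)
    (hzinv : Integrable (fun ω => 1 / z ω) μ)
    (hzmean : ∫ ω, 1 / z ω ∂μ = 1 / ((M : ℝ) - N))
    (A : ι → Ω → ℝ) (hAm : ∀ k, Measurable (A k))
    (hAnn : ∀ k, ∀ᵐ ω ∂μ, 0 ≤ A k ω)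
    (hAint : ∀ k, Integrable (A k) μ)
    (hAmean : ∀ k, ∫ ω, A k ω ∂μ = βk k)
    (S : Ω → ℝ) (hS : S = fun ω => ∑ k, pk k * A k ω)
    (hzS : IndepFun z S μ)
    (hlogint : Integrable (fun ω => Real.logb 2 (1 + p * β * z ω / (S ω + 1))) μ) :
    Real.logb 2 (1 + p * β * ((M : ℝ) - N) / ((∑ k, pk k * βk k) + 1))
      ≤ ∫ ω, Real.logb 2 (1 + p * β * z ω / (S ω + 1)) ∂μ := by
  have hMN' : (0 : ℝ) < (M : ℝ) - N := sub_pos.mpr (by exact_mod_cast hMN)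
  have hB : 0 ≤ ∑ k, pk k * βk k :=
    Finset.sum_nonneg fun k _ => mul_nonneg (hpk k) (hβk k).le
  have hSint : Integrable S μ := by
    rw [hS]
    exact integrable_finsetSum _ fun k _ => (hAint k).const_mul _
  have hSmean : ∫ ω, S ω ∂μ = ∑ k, pk k * βk k := by
    rw [hS]
    rw [integral_finsetSum _ fun k _ => (hAint k).const_mul _]
    simp only [integral_const_mul, hAmean]
  have hSnn : ∀ᵐ ω ∂μ, 0 ≤ S ω := by
    filter_upwards [ae_all_iff.mpr hAnn] with ω h
    rw [hS]
    exact Finset.sum_nonneg fun k _ => mul_nonneg (hpk k) (h k)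
  have hS1int : Integrable (fun ω => S ω + 1) μ := hSint.add (integrable_const 1)
  have hind : IndepFun (fun ω => 1 / z ω) (fun ω => S ω + 1) μ :=
    hzS.comp (φ := fun x : ℝ => 1 / x) (ψ := fun x : ℝ => x + 1) (by fun_prop) (by fun_prop)
  have hDint : Integrable (fun ω => 1 / z ω * (S ω + 1)) μ :=
    hind.integrable_mul hzinv hS1int
  have hDmean : ∫ ω, 1 / z ω * (S ω + 1) ∂μ
      = ((∑ k, pk k * βk k) + 1) / ((M : ℝ) - N) := by
    rw [hind.integral_fun_mul_eq_mul_integral hzinv.aestronglyMeasurable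
      hS1int.aestronglyMeasurable, hzmean, integral_add hSint (integrable_const 1), hSmean]
    simp
    ring
  set m : ℝ := ((∑ k, pk k * βk k) + 1) / ((M : ℝ) - N) with hm
  have hmpos : 0 < m := by positivity
  have hc : 0 < p * β := by positivity
  have hl2 : 0 < Real.log 2 := Real.log_pos (by norm_num)
  have hle : p * β * ((M : ℝ) - N) / ((∑ k, pk k * βk k) + 1) = p * β / m := by
    rw [hm]
    field_simp
  rw [hle]
  set t : ℝ := p * β / (m * (m + p * β)) with ht
  have hDi : Integrable (fun ω => m - 1 / z ω * (S ω + 1)) μ := (integrable_const m).sub hDint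
  have hzero : ∫ ω, (m - 1 / z ω * (S ω + 1)) ∂μ = 0 := by
    rw [integral_sub (integrable_const m) hDint, hDmean]
    simp
  have hli : Integrable (fun ω => Real.logb 2 (1 + p * β / m)
      + t / Real.log 2 * (m - 1 / z ω * (S ω + 1))) μ :=
    (integrable_const _).add (hDi.const_mul _)
  calc Real.logb 2 (1 + p * β / m)
      = ∫ ω, (Real.logb 2 (1 + p * β / m)
          + t / Real.log 2 * (m - 1 / z ω * (S ω + 1))) ∂μ := by
        rw [integral_add (integrable_const _) (hDi.const_mul _), integral_const_mul, hzero]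
        simp
    _ ≤ _ := by
        refine integral_mono_ae hli hlogint ?_
        filter_upwards [hzpos, hSnn] with ω h1 h2
        have hx : 0 < 1 / z ω * (S ω + 1) := by positivity
        have h := tangent_aux (p * β) m _ hc hmpos hx
        have he : p * β / (1 / z ω * (S ω + 1)) = p * β * z ω / (S ω + 1) := by
          field_simp
        rw [he] at h
        have h3 := div_le_div_of_nonneg_right h hl2.le
        simp only [Real.logb]
        refine le_trans (le_of_eq ?_) h3
        rw [ht]
        ring
end

section
/- Let N ≥ 1 be a natural number, c_n > 0 for n = 1,…,N real constants, and P > 0. For each natural number m ≥ 1 define d_n(m) = c_n · m, and let μ(m) be the unique real number satisfying Σ_{n=1}^{N} (μ(m) − 1/d_n(m))^+ = P. Then for every n, the water-filling power (μ(m) − 1/d_n(m))^+ converges to P/N as m → ∞; that is, the optimal power allocation converges to the equal power assignment. -/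
/-- As the effective gains `d_n(m) = c_n m` grow linearly in `m`, the water-filling powers
`(μ(m) − 1/d_n(m))⁺` (with the water level `μ(m)` defined by `Σ_n (μ(m) − 1/d_n(m))⁺ = P`)
converge to the equal power assignment `P/N`. -/
theorem stmt15
    (N : ℕ) (hN : 1 ≤ N) (c : Fin N → ℝ) (hc : ∀ n, 0 < c n) (P : ℝ) (hP : 0 < P)
    (μ : ℕ → ℝ)
    (hμ : ∀ m : ℕ, 1 ≤ m → ∑ n, max (μ m - 1 / (c n * (m : ℝ))) 0 = P) :
    ∀ n, Filter.Tendsto (fun m : ℕ => max (μ m - 1 / (c n * (m : ℝ))) 0)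
      Filter.atTop (nhds (P / N)) := by
  intro n
  have hN0 : (N : ℝ) ≠ 0 := by
    have : N ≠ 0 := by omega
    exact_mod_cast this
  have he : ∀ k, Filter.Tendsto (fun m : ℕ => 1 / (c k * (m : ℝ))) Filter.atTop (nhds 0) := by
    intro k
    have h := (tendsto_natCast_atTop_atTop (R := ℝ)).const_mul_atTop (hc k)
    simp only [one_div]
    exact h.inv_tendsto_atTop
  have hd : ∀ k, Filter.Tendsto (fun m : ℕ => max (μ m - 1 / (c n * (m : ℝ))) 0
      - max (μ m - 1 / (c k * (m : ℝ))) 0) Filter.atTop (nhds 0) := by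
    intro k
    have h := ((he n).sub (he k)).abs
    rw [sub_zero, abs_zero] at h
    refine squeeze_zero_norm (fun m => ?_) h
    rw [Real.norm_eq_abs]
    refine (abs_max_sub_max_le_abs _ _ _).trans (le_of_eq ?_)
    rw [sub_sub_sub_cancel_left, abs_sub_comm]
  have hs := tendsto_finsetSum Finset.univ (fun k _ => hd k)
  have h2 := (hs.div_const (N : ℝ)).const_add (P / N)
  simp only [Finset.sum_const_zero, zero_div, add_zero] at h2
  refine h2.congr' ?_
  filter_upwards [Filter.eventually_ge_atTop 1] with m hm
  rw [Finset.sum_sub_distrib, hμ m hm, Finset.sum_const, Finset.card_univ, Fintype.card_fin,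
    nsmul_eq_mul]
  field_simp
  ring
end
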